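/- arXiv:2301.13406 — 9 statements merged into one kernel-verified Lean document; each statement's English description precedes it below -/
import Mathlib

section
/- Let R be a finite FL_ew-algebra in which the only idempotent elements (elements x with x ⊙ x = x) are 0 and 1. Then there exists n ≥ 1 such that x ∨ ¬(xⁿ) = 1 for every x ∈ R. -/
/-- The `n`-th power of `x` with respect to a binary operation `mul` with unit `one`. -/
def flPow {R : Type*} (mul : R → R → R) (one : R) (x : R) : ℕ → R
  | 0 => one
  | n + 1 => mul x (flPow mul one x n)

theorem flPow_add {R : Type*} {mul : R → R → R} {one : R}
    (mul_assoc : ∀ x y z : R, mul (mul x y) z = mul x (mul y z))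
    (one_mul : ∀ x : R, mul one x = x) (x : R) (m n : ℕ) :
    flPow mul one x (m + n) = mul (flPow mul one x m) (flPow mul one x n) := by
  induction m with
  | zero => rw [Nat.zero_add]; exact (one_mul _).symm
  | succ m ih =>
    rw [Nat.succ_add]
    simp only [flPow]
    rw [ih, mul_assoc]

theorem flPow_antitone {R : Type*} [Preorder R] {mul : R → R → R}
    (mul_le_right : ∀ x y : R, mul x y ≤ y) (one x : R) :
    Antitone (flPow mul one x) :=
  antitone_nat_of_succ_le fun _ => mul_le_right _ _

/-- Let `R` be a finite FL_ew-algebra (a bounded lattice with a commutative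
monoid operation `mul` whose unit is the top element `1 = ⊤`, together with a residuum
`himp` satisfying the residuation law) in which the only idempotent elements are `0 = ⊥`
and `1 = ⊤`.  Then there exists `n ≥ 1` such that `x ⊔ ¬(xⁿ) = 1` for every `x`,
where `¬ x = x → 0`. -/
theorem flew_idempotents_bot_top_implies_quasiprimal_eq
    {R : Type*} [Fintype R] [Lattice R] [BoundedOrder R]
    (mul : R → R → R) (himp : R → R → R)
    (mul_comm : ∀ x y : R, mul x y = mul y x)
    (mul_assoc : ∀ x y z : R, mul (mul x y) z = mul x (mul y z))
    (mul_one : ∀ x : R, mul x ⊤ = x)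
    (resid : ∀ x y z : R, mul x y ≤ z ↔ x ≤ himp y z)
    (idem : ∀ x : R, mul x x = x → x = ⊥ ∨ x = ⊤) :
    ∃ n : ℕ, 1 ≤ n ∧ ∀ x : R, x ⊔ himp (flPow mul ⊤ x n) ⊥ = ⊤ := by
  have top_mul (y : R) : mul ⊤ y = y := by rw [mul_comm, mul_one]
  have mul_le_right (x y : R) : mul x y ≤ y :=
    (resid x y y).2 (le_top.trans ((resid ⊤ y y).1 (top_mul y).le))
  have anti (x : R) : Antitone (flPow mul ⊤ x) := flPow_antitone mul_le_right ⊤ x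
  have stable (x : R) : ∃ N, ∀ m, N ≤ m → flPow mul ⊤ x N = flPow mul ⊤ x m :=
    WellFoundedGT.monotone_chain_condition
      (⟨fun k => OrderDual.toDual (flPow mul ⊤ x k), fun _ _ h => anti x h⟩ : ℕ →o Rᵒᵈ)
  choose N hN using stable
  refine ⟨Finset.univ.sup N + 1, Nat.le_add_left _ _, fun x => ?_⟩
  set n := Finset.univ.sup N + 1
  have hn : N x ≤ n := (Finset.le_sup (Finset.mem_univ x)).trans (Nat.le_succ _)
  have hidem : mul (flPow mul ⊤ x n) (flPow mul ⊤ x n) = flPow mul ⊤ x n := by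
    rw [← flPow_add mul_assoc top_mul, ← hN x n hn, ← hN x (n + n) (hn.trans (Nat.le_add_left _ _))]
  rcases idem _ hidem with h | h
  · rw [h, eq_top_iff]
    exact ((resid ⊤ ⊥ ⊥).1 (top_mul ⊥).le).trans le_sup_right
  · have hx : flPow mul ⊤ x n ≤ x := by
      simpa only [n, flPow, mul_one] using anti x (Nat.le_add_left 1 (Finset.univ.sup N))
    rw [h, top_le_iff] at hx
    rw [hx, top_sup_eq]
end

section
/- Let R be a finite FL_ew-algebra whose lattice order is total (R is a chain). If there exists n ≥ 1 such that x ∨ ¬(xⁿ) = 1 for every x ∈ R, then the only idempotent elements of R (elements x with x ⊙ x = x) are 0 and 1. -/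
/-- Every positive power of an idempotent element is the element itself. -/
theorem flPow_succ_of_idempotent {R : Type*} (mul : R → R → R) (one x : R)
    (mul_one : mul x one = x) (hx : mul x x = x) (n : ℕ) :
    flPow mul one x (n + 1) = x := by
  induction n with
  | zero => exact mul_one
  | succ k ih => rw [flPow, ih, hx]

/-- Let `R` be a finite FL_ew-algebra (a bounded lattice with a commutative
monoid operation `mul` whose unit is the top element `1 = ⊤`, together with a residuum
`himp` satisfying the residuation law) whose lattice order is total (a chain).
If there exists `n ≥ 1` such that `x ⊔ ¬(xⁿ) = 1` for every `x` (where `¬ x = x → 0`),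
then the only idempotent elements of `R` are `0 = ⊥` and `1 = ⊤`. -/
theorem flew_chain_quasiprimal_eq_implies_idempotents_bot_top
    {R : Type*} [Fintype R] [Lattice R] [BoundedOrder R]
    (total : ∀ x y : R, x ≤ y ∨ y ≤ x)
    (mul : R → R → R) (himp : R → R → R)
    (mul_comm : ∀ x y : R, mul x y = mul y x)
    (mul_assoc : ∀ x y z : R, mul (mul x y) z = mul x (mul y z))
    (mul_one : ∀ x : R, mul x ⊤ = x)
    (resid : ∀ x y z : R, mul x y ≤ z ↔ x ≤ himp y z)
    (h : ∃ n : ℕ, 1 ≤ n ∧ ∀ x : R, x ⊔ himp (flPow mul ⊤ x n) ⊥ = ⊤) :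
    ∀ x : R, mul x x = x → x = ⊥ ∨ x = ⊤ := by
  intro x hx
  obtain ⟨n, hn, h⟩ := h
  obtain ⟨m, rfl⟩ := Nat.exists_eq_add_of_le' hn
  have hsup := h x
  rw [flPow_succ_of_idempotent mul ⊤ x (mul_one x) hx m] at hsup
  rcases total x (himp x ⊥) with hle | hle
  · left
    have htop : (⊤ : R) ≤ himp x ⊥ := by rw [← hsup, sup_eq_right.mpr hle]
    have hbot := (resid ⊤ x ⊥).mpr htop
    rwa [mul_comm, mul_one, le_bot_iff] at hbot
  · right
    rwa [sup_eq_left.mpr hle] at hsup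
end

section
/- Let M be a finite type and let (B_i)_{i ∈ I} be a family of Boolean algebras, with product Boolean algebra ∏_{i∈I} B_i (operations computed componentwise). The map sending ξ ∈ M[∏_{i∈I} B_i] to the family (ξ_i)_{i∈I}, where ξ_i(ℓ) is the i-th component of ξ(ℓ), is a well-defined bijection from M[∏_{i∈I} B_i] onto ∏_{i∈I} M[B_i]. -/
/-- The carrier of the Boolean power `M[B]`: functions `ξ : M → B` whose values are
pairwise disjoint and whose join over all of `M` is `⊤`. -/
def BoolPower (M : Type*) [Fintype M] (B : Type*) [BooleanAlgebra B] : Set (M → B) :=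
  {ξ | (∀ ℓ ℓ' : M, ℓ ≠ ℓ' → ξ ℓ ⊓ ξ ℓ' = ⊥) ∧ Finset.univ.sup ξ = ⊤}

/-- A function into a product of Boolean algebras lies in the Boolean power iff each of its
components does. -/
theorem mem_boolPower_pi_iff {M : Type*} [Fintype M] {I : Type*} {B : I → Type*}
    [∀ i, BooleanAlgebra (B i)] {ξ : M → ∀ i, B i} :
    ξ ∈ BoolPower M (∀ i, B i) ↔ ∀ i, (fun ℓ => ξ ℓ i) ∈ BoolPower M (B i) := by
  simp only [BoolPower, Set.mem_ofPred_eq, funext_iff, Finset.sup_apply, Pi.inf_apply,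
    Pi.bot_apply, Pi.top_apply, forall_and]
  exact and_congr_left' ⟨fun h i ℓ ℓ' hne => h ℓ ℓ' hne i, fun h ℓ ℓ' hne i => h i ℓ ℓ' hne⟩

/-- Let `M` be a finite type and `(B i)_{i ∈ I}` a family of Boolean
algebras, with product Boolean algebra `∀ i, B i` (operations computed componentwise).
The map sending `ξ ∈ M[∀ i, B i]` to the family of its components is a well-defined
bijection from `M[∀ i, B i]` onto `∏_{i ∈ I} M[B i]`:  there is an equivalence
`e` whose action is exactly `(e ξ) i ℓ = ξ ℓ i`. -/
theorem boolPower_pi_equiv (M : Type) [Fintype M] (I : Type*) (B : I → Type*)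
    [∀ i, BooleanAlgebra (B i)] :
    ∃ e : (BoolPower M (∀ i, B i)) ≃ (∀ i, BoolPower M (B i)),
      ∀ (ξ : BoolPower M (∀ i, B i)) (i : I) (ℓ : M),
        ((e ξ i : M → B i) ℓ) = (ξ : M → ∀ i, B i) ℓ i := by
  exact ⟨{
    toFun := fun ξ i => ⟨fun ℓ => ξ.1 ℓ i, mem_boolPower_pi_iff.1 ξ.2 i⟩
    invFun := fun η => ⟨fun ℓ i => (η i).1 ℓ, mem_boolPower_pi_iff.2 fun i => (η i).2⟩
    left_inv := fun _ => rfl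
    right_inv := fun _ => rfl }, fun _ _ _ => rfl⟩
end

section
/- Let F be a finite lattice, and let Set_F^ω denote the full subcategory of Set_F on objects (X, v) with X a finite set. Then the Ind-completion (the free cocompletion under filtered colimits) of Set_F^ω is equivalent to Set_F; equivalently, the inclusion Set_F^ω ↪ Set_F exhibits Set_F as the Ind-completion of Set_F^ω. -/
open CategoryTheory

/-- An object of the category `Set_F`: a set `X` together with a map `v : X → F`. -/
structure SetF (F : Type) [Lattice F] : Type 1 where
  X : Type
  v : X → F

/-- The category `Set_F`: morphisms `(X, v) → (Y, w)` are functions `f : X → Y` with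
`w (f x) ≤ v x` for all `x`. -/
instance SetF.category (F : Type) [Lattice F] : Category (SetF F) where
  Hom A B := {f : A.X → B.X // ∀ x, B.v (f x) ≤ A.v x}
  id A := ⟨id, fun _ => le_rfl⟩
  comp f g := ⟨g.1 ∘ f.1, fun x => (g.2 _).trans (f.2 _)⟩
  id_comp _ := rfl
  comp_id _ := rfl
  assoc _ _ _ := rfl

/-- An object of `Set_F^ω`: a *finite* set `X` together with a map `v : X → F`. -/
structure SetFinF (F : Type) [Lattice F] : Type 1 where
  X : Type
  [fin : Finite X]
  v : X → F

attribute [instance] SetFinF.fin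

/-- The category `Set_F^ω` of finite objects of `Set_F`. -/
instance SetFinF.category (F : Type) [Lattice F] : Category (SetFinF F) where
  Hom A B := {f : A.X → B.X // ∀ x, B.v (f x) ≤ A.v x}
  id A := ⟨id, fun _ => le_rfl⟩
  comp f g := ⟨g.1 ∘ f.1, fun x => (g.2 _).trans (f.2 _)⟩
  id_comp _ := rfl
  comp_id _ := rfl
  assoc _ _ _ := rfl

/-- The full inclusion `Set_F^ω ↪ Set_F`. -/
def setIota (F : Type) [Lattice F] : SetFinF F ⥤ SetF F where
  obj A := ⟨A.X, A.v⟩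
  map f := ⟨f.1, f.2⟩
  map_id _ := rfl
  map_comp _ _ := rfl

open Limits Opposite

namespace SetFinF

variable {F : Type} [Lattice F]

/-- The one-point object of `Set_F^ω` with value `t`. -/
def point (t : F) : SetFinF F where
  X := PUnit
  v _ := t

/-- The morphism from a one-point object selecting an element. -/
def pointHom (A : SetFinF F) (t : F) (x : A.X) (h : A.v x ≤ t) : point t ⟶ A :=
  ⟨fun _ => x, fun _ => h⟩

end SetFinF

namespace SetF

variable {F : Type} [Lattice F]

/-- The functor sending an object `A` of `Set_F` to the presheaf `Hom(-, A)` on `Set_F^ω`. -/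
def nerve (F : Type) [Lattice F] : SetF F ⥤ (SetFinF F)ᵒᵖ ⥤ Type :=
  yoneda ⋙ (Functor.whiskeringLeft _ _ _).obj (setIota F).op

/-- The morphism from a one-point object selecting an element. -/
def pointHom (A : SetF F) (t : F) (x : A.X) (h : A.v x ≤ t) :
    (setIota F).obj (SetFinF.point t) ⟶ A :=
  ⟨fun _ => x, fun _ => h⟩

/-- The map of underlying sets recovered from a map of nerves by evaluation at points. -/
def nervePreimage {A B : SetF F} (η : (nerve F).obj A ⟶ (nerve F).obj B) : A ⟶ B :=
  ⟨fun x => (show (setIota F).obj (SetFinF.point (A.v x)) ⟶ B from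
      η.app (op (SetFinF.point (A.v x))) (pointHom A (A.v x) x le_rfl)).1 PUnit.unit,
    fun x => (show (setIota F).obj (SetFinF.point (A.v x)) ⟶ B from
      η.app (op (SetFinF.point (A.v x))) (pointHom A (A.v x) x le_rfl)).2 PUnit.unit⟩

lemma nerve_naturality {A B : SetF F} (η : (nerve F).obj A ⟶ (nerve F).obj B)
    {Y Z : SetFinF F} (f : Y ⟶ Z) (g : (setIota F).obj Z ⟶ A) :
    (show (setIota F).obj Y ⟶ B from η.app (op Y) ((setIota F).map f ≫ g)) =
      (setIota F).map f ≫ (show (setIota F).obj Z ⟶ B from η.app (op Z) g) :=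
  ConcreteCategory.congr_hom (η.naturality f.op) g

lemma nerve_app_eq {A B : SetF F} (η : (nerve F).obj A ⟶ (nerve F).obj B)
    {Y : SetFinF F} (g : (setIota F).obj Y ⟶ A) :
    (show (setIota F).obj Y ⟶ B from η.app (op Y) g) = g ≫ nervePreimage η := by
  apply Subtype.ext
  funext y
  have h₁ := congrArg (fun k => k.1 PUnit.unit)
    (nerve_naturality η (SetFinF.pointHom Y (Y.v y) y le_rfl) g)
  have h₂ := congrArg (fun k => k.1 PUnit.unit)
    (nerve_naturality η (SetFinF.pointHom (SetFinF.point (A.v (g.1 y))) (Y.v y) PUnit.unit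
      (g.2 y)) (pointHom A _ (g.1 y) le_rfl))
  exact h₁.symm.trans h₂

/-- The nerve functor is fully faithful, i.e. `Set_F^ω` is dense in `Set_F`. -/
def nerveFullyFaithful (F : Type) [Lattice F] : (nerve F).FullyFaithful where
  preimage η := nervePreimage η
  map_preimage η := by
    ext Y g
    exact (nerve_app_eq η g).symm
  preimage_map _ := rfl

section FilteredColimits

variable {I : Type} [SmallCategory I] {D : I ⥤ SetFinF F}

lemma cocone_w_apply (c : Cocone (D ⋙ setIota F)) {i j : I} (f : i ⟶ j) (x : (D.obj i).X) :
    (c.ι.app j).1 ((D.map f).1 x) = (c.ι.app i).1 x :=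
  congrArg (fun k => k.1 x) (c.w f)

lemma map_comp_apply (D : I ⥤ SetFinF F) {i j k : I} (f : i ⟶ j) (g : j ⟶ k)
    (x : (D.obj i).X) : (D.map (f ≫ g)).1 x = (D.map g).1 ((D.map f).1 x) :=
  congrArg (fun k => k.1 x) (D.map_comp f g)

/-- The cocone of presheaves induced by a cocone in `Set_F` over a diagram of finite objects. -/
def nerveCocone (c : Cocone (D ⋙ setIota F)) : Cocone (D ⋙ yoneda) where
  pt := (nerve F).obj c.pt
  ι :=
    { app i := { app Y := ↾fun g => (setIota F).map g ≫ c.ι.app i }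
      naturality i j f := by
        ext Y g
        apply Subtype.ext
        funext y
        exact cocone_w_apply c f (g.1 y) }

variable [IsFiltered I]

lemma exists_lift (c : Cocone (D ⋙ setIota F))
    (hsurj : ∀ z : c.pt.X, ∃ (i : I) (x : (D.obj i).X),
      (c.ι.app i).1 x = z ∧ (D.obj i).v x ≤ c.pt.v z)
    {Y : SetFinF F} (g : (setIota F).obj Y ⟶ c.pt) :
    ∃ (i : I) (f : Y ⟶ D.obj i), g = (setIota F).map f ≫ c.ι.app i := by
  choose i x hx hv using hsurj
  have := Fintype.ofFinite Y.X
  classical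
  obtain ⟨k, hk⟩ := IsFiltered.sup_objs_exists (Finset.univ.image fun y : Y.X => i (g.1 y))
  have hk' (y : Y.X) : Nonempty (i (g.1 y) ⟶ k) :=
    hk (Finset.mem_image_of_mem _ (Finset.mem_univ y))
  refine ⟨k, ⟨fun y => (D.map (hk' y).some).1 (x (g.1 y)), fun y => ?_⟩, ?_⟩
  · exact ((D.map (hk' y).some).2 _).trans ((hv _).trans (g.2 y))
  · apply Subtype.ext
    funext y
    exact ((cocone_w_apply c (hk' y).some _).trans (hx _)).symm

lemma exists_map_eq {i : I} {T : Type} [Finite T] (p q : T → (D.obj i).X)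
    (h : ∀ t, ∃ (j : I) (f : i ⟶ j), (D.map f).1 (p t) = (D.map f).1 (q t)) :
    ∃ (j : I) (f : i ⟶ j), ∀ t, (D.map f).1 (p t) = (D.map f).1 (q t) := by
  have := Fintype.ofFinite T
  classical
  suffices H : ∀ s : Finset T, ∃ (j : I) (f : i ⟶ j), ∀ t ∈ s,
      (D.map f).1 (p t) = (D.map f).1 (q t) by
    obtain ⟨j, f, hf⟩ := H Finset.univ
    exact ⟨j, f, fun t => hf t (Finset.mem_univ t)⟩
  intro s
  induction s using Finset.induction_on with
  | empty => exact ⟨i, 𝟙 i, by simp⟩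
  | insert t s _ ih =>
    obtain ⟨j, f, hf⟩ := ih
    obtain ⟨j', f', hf'⟩ := h t
    obtain ⟨k, g, g', hg⟩ := IsFiltered.span f f'
    refine ⟨k, f ≫ g, fun u hu => ?_⟩
    rcases Finset.mem_insert.1 hu with rfl | hu
    · rw [hg, map_comp_apply, map_comp_apply, hf']
    · rw [map_comp_apply, map_comp_apply, hf u hu]

/-- Nerves turn concretely described filtered colimits of finite objects into colimits. -/
noncomputable def isColimitNerveCocone (c : Cocone (D ⋙ setIota F))
    (hsurj : ∀ z : c.pt.X, ∃ (i : I) (x : (D.obj i).X),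
      (c.ι.app i).1 x = z ∧ (D.obj i).v x ≤ c.pt.v z)
    (hinj : ∀ (i : I) (x y : (D.obj i).X), (c.ι.app i).1 x = (c.ι.app i).1 y →
      ∃ (j : I) (f : i ⟶ j), (D.map f).1 x = (D.map f).1 y) :
    IsColimit (nerveCocone c) :=
  evaluationJointlyReflectsColimits _ fun Y =>
    Types.FilteredColimit.isColimitOf' _ _ (exists_lift c hsurj) fun i p q hpq => by
      obtain ⟨j, f, hf⟩ := exists_map_eq (D := D) (T := Y.unop.X) (Subtype.val p)
        (Subtype.val q) fun t => hinj i _ _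
          (congrArg (fun k : (setIota F).obj Y.unop ⟶ c.pt => k.1 t) hpq)
      exact ⟨j, f, Subtype.ext (funext hf)⟩

end FilteredColimits

/-- The diagram of finite subobjects of an object of `Set_F`. -/
def finiteSubsets (A : SetF F) : Finset A.X ⥤ SetFinF F where
  obj s := ⟨{x // x ∈ s}, fun x => A.v x.1⟩
  map f := ⟨fun x => ⟨x.1, leOfHom f x.2⟩, fun _ => le_rfl⟩

/-- An object of `Set_F` as a cocone over its finite subobjects. -/
def finiteSubsetsCocone (A : SetF F) : Cocone (A.finiteSubsets ⋙ setIota F) where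
  pt := A
  ι := { app s := ⟨fun x => x.1, fun _ => le_rfl⟩ }

lemma isIndObject_nerve (A : SetF F) : IsIndObject ((nerve F).obj A) := by
  classical
  exact ⟨⟨IndObjectPresentation.ofCocone _ (isColimitNerveCocone A.finiteSubsetsCocone
    (fun z => ⟨{z}, ⟨z, Finset.mem_singleton_self z⟩, rfl, le_rfl⟩)
    (fun i _ _ h => ⟨i, 𝟙 i, Subtype.ext h⟩))⟩⟩

section Colimit

variable [Finite F] {I : Type} [SmallCategory I] [IsFiltered I] (D : I ⥤ SetFinF F)

/-- The diagram of underlying sets. -/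
def underlying (D : I ⥤ SetFinF F) : I ⥤ Type where
  obj i := (D.obj i).X
  map f := ↾(D.map f).1
  map_id i := by
    ext x
    exact congrArg (fun k => k.1 x) (D.map_id i)
  map_comp f g := by
    ext x
    exact map_comp_apply D f g x

/-- Values decrease along a filtered diagram in a finite lattice, so the infimum over the
representatives of an element of the colimit is attained. -/
lemma exists_least_representative (z : (colimit (underlying D) : Type)) :
    ∃ (i : I) (x : (D.obj i).X), colimit.ι (underlying D) i x = z ∧
      ∀ (j : I) (y : (D.obj j).X), colimit.ι (underlying D) j y = z →
        (D.obj i).v x ≤ (D.obj j).v y := by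
  let S : Set F := {t | ∃ (i : I) (x : (D.obj i).X),
    colimit.ι (underlying D) i x = z ∧ (D.obj i).v x = t}
  have hS : S.Nonempty := by
    obtain ⟨i, x, hx⟩ := Types.jointly_surjective' z
    exact ⟨_, i, x, hx, rfl⟩
  obtain ⟨t, ⟨i, x, hx, rfl⟩, hmin⟩ := S.toFinite.exists_minimal hS
  refine ⟨i, x, hx, fun j y hy => ?_⟩
  obtain ⟨k, f, g, hfg⟩ := (Types.FilteredColimit.colimit_eq_iff (underlying D)).1
    (hx.trans hy.symm)
  have hk : (D.obj k).v ((D.map f).1 x) ∈ S :=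
    ⟨k, (D.map f).1 x, (ConcreteCategory.congr_hom (colimit.w (underlying D) f) x).trans hx, rfl⟩
  have hfg' : (D.map f).1 x = (D.map g).1 y := hfg
  refine (hmin hk ((D.map f).2 x)).trans ?_
  rw [hfg']
  exact (D.map g).2 y

/-- A cocone in `Set_F` whose value function is the infimum over all representatives. -/
noncomputable def colimitCocone : Cocone (D ⋙ setIota F) where
  pt :=
    { X := (colimit (underlying D) : Type)
      v z := (D.obj (exists_least_representative D z).choose).v
        (exists_least_representative D z).choose_spec.choose }
  ι :=
    { app i := ⟨fun x => colimit.ι (underlying D) i x, fun x =>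
        (exists_least_representative D _).choose_spec.choose_spec.2 i x rfl⟩
      naturality _ _ f := Subtype.ext (funext fun x =>
        ConcreteCategory.congr_hom (colimit.w (underlying D) f) x) }

/-- The nerve of the colimit cocone is a colimit cocone. -/
noncomputable def isColimitNerveColimitCocone : IsColimit (nerveCocone (colimitCocone D)) :=
  isColimitNerveCocone _
    (fun z => ⟨_, _, (exists_least_representative D z).choose_spec.choose_spec.1, le_rfl⟩)
    (fun i x y h => (Types.FilteredColimit.isColimit_eq_iff' (colimit.isColimit (underlying D))
      (i := i) x y).1 h)

end Colimit

lemma exists_nerve_iso [Finite F] {P : (SetFinF F)ᵒᵖ ⥤ Type} (hP : IsIndObject P) :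
    ∃ A : SetF F, Nonempty ((nerve F).obj A ≅ P) :=
  ⟨_, ⟨(isColimitNerveColimitCocone hP.presentation.F).coconePointUniqueUpToIso
    hP.presentation.coconeIsColimit⟩⟩

/-- The nerve functor with values in ind-objects. -/
noncomputable def toInd (F : Type) [Lattice F] : SetF F ⥤ Ind (SetFinF F) :=
  ObjectProperty.lift _ (nerve F) isIndObject_nerve ⋙ (Ind.equivalence (SetFinF F)).inverse

/-- As a presheaf, the ind-object attached to an object of `Set_F` is its nerve. -/
noncomputable def toIndCompInclusion (F : Type) [Lattice F] :
    toInd F ⋙ Ind.inclusion (SetFinF F) ≅ nerve F :=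
  Functor.isoWhiskerLeft (ObjectProperty.lift _ _ isIndObject_nerve)
    (Functor.isoWhiskerRight (Ind.equivalence (SetFinF F)).counitIso (ObjectProperty.ι _))

/-- `Set_F → Ind(Set_F^ω)` is fully faithful. -/
noncomputable def toIndFullyFaithful (F : Type) [Lattice F] : (toInd F).FullyFaithful :=
  ((nerveFullyFaithful F).ofIso (toIndCompInclusion F).symm).ofCompFaithful

lemma toInd_essSurj [Finite F] : (toInd F).EssSurj where
  mem_essImage P := by
    obtain ⟨A, ⟨e⟩⟩ := exists_nerve_iso ((Ind.equivalence (SetFinF F)).functor.obj P).property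
    exact ⟨A, ⟨Ind.inclusion.fullyFaithful.preimageIso ((toIndCompInclusion F).app A ≪≫ e)⟩⟩

/-- The nerve of a finite object is representable. -/
def iotaCompNerve (F : Type) [Lattice F] : setIota F ⋙ nerve F ≅ yoneda :=
  NatIso.ofComponents fun A => NatIso.ofComponents fun Y =>
    { hom := ↾fun g => ⟨g.1, g.2⟩
      inv := ↾fun g => ⟨g.1, g.2⟩ }

/-- The inclusion `Set_F^ω → Set_F` corresponds to the canonical embedding into ind-objects. -/
noncomputable def iotaCompToInd (F : Type) [Lattice F] : setIota F ⋙ toInd F ≅ Ind.yoneda :=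
  Ind.inclusion.fullyFaithful.whiskeringRight _ |>.preimageIso
    (Functor.isoWhiskerLeft (setIota F) (toIndCompInclusion F) ≪≫ iotaCompNerve F ≪≫
      Ind.yonedaCompInclusion.symm)

end SetF

/-- For a finite lattice `F`, the Ind-completion (free cocompletion under
filtered colimits) of `Set_F^ω` is equivalent to `Set_F`; moreover the equivalence is
compatible with the canonical embedding `Set_F^ω → Ind(Set_F^ω)` and the inclusion
`Set_F^ω ↪ Set_F`, i.e. the inclusion exhibits `Set_F` as the Ind-completion of
`Set_F^ω`. -/
theorem setF_is_ind_completion (F : Type) [Fintype F] [Lattice F] :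
    ∃ e : Ind (SetFinF F) ≌ SetF F,
      Nonempty (Ind.yoneda ⋙ e.functor ≅ setIota F) := by
  have := (SetF.toIndFullyFaithful F).full
  have := (SetF.toIndFullyFaithful F).faithful
  have := SetF.toInd_essSurj (F := F)
  have : (SetF.toInd F).IsEquivalence := {}
  let e := (SetF.toInd F).asEquivalence
  exact ⟨e.symm, ⟨Functor.isoWhiskerRight (SetF.iotaCompToInd F).symm e.inverse ≪≫
    Functor.isoWhiskerLeft (setIota F) e.unitIso.symm⟩⟩
end

section
/- Let F be a finite lattice and ((X_i, v_i))_{i∈I} a family of objects of Stone_F. Equip the product space ∏_{i∈I} X_i with the product topology and define v : ∏_{i∈I} X_i → F by v(p) = ⋁_{i∈I} v_i(p_i). Then (∏_{i∈I} X_i, v) is an object of Stone_F and, together with the projection maps, is a categorical product of the family ((X_i, v_i))_{i∈I} in Stone_F. Moreover, Stone_F has all small limits. -/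
open CategoryTheory

set_option autoImplicit false

/-- An object of the category `Stone_F`: a Stone space `X` (a `Profinite` space) together
with a map `v : X → F` such that each down-set preimage `{x | v x ≤ S}` is closed. -/
structure StoneF (F : Type) [Lattice F] : Type 1 where
  X : Profinite.{0}
  v : X → F
  closed : ∀ S : F, IsClosed {x : X | v x ≤ S}

/-- The category `Stone_F`: morphisms `(X, v) → (Y, w)` are continuous maps `f : X → Y`
with `w (f x) ≤ v x` for all `x`. -/
instance StoneF.category (F : Type) [Lattice F] : Category (StoneF F) where
  Hom A B := {f : A.X → B.X // Continuous f ∧ ∀ x, B.v (f x) ≤ A.v x}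
  id A := ⟨id, continuous_id, fun _ => le_rfl⟩
  comp f g := ⟨g.1 ∘ f.1, g.2.1.comp f.2.1, fun x => (g.2.2 _).trans (f.2.2 _)⟩
  id_comp _ := rfl
  comp_id _ := rfl
  assoc _ _ _ := rfl

section Prod
variable (F : Type) [Fintype F] [CompleteLattice F] (I : Type) (A : I → StoneF F)

/-- The product of a family of objects of `Stone_F`: the product space with the
pointwise-join value map `v p = ⨆ i, v_i (p i)`. -/
def StoneF.prodObj : StoneF F where
  X := Profinite.of (∀ i, (A i).X)
  v p := ⨆ i, (A i).v (p i)
  closed S := by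
    have h : {p : ∀ i, (A i).X | (⨆ i, (A i).v (p i)) ≤ S} =
        ⋂ i, (fun p : ∀ i, (A i).X => p i) ⁻¹' {x : (A i).X | (A i).v x ≤ S} := by
      ext p
      simp [iSup_le_iff]
    show IsClosed {p : ∀ i, (A i).X | (⨆ i, (A i).v (p i)) ≤ S}
    rw [h]
    exact isClosed_iInter fun i => ((A i).closed S).preimage (continuous_apply i)

/-- The projections out of the product object. -/
def StoneF.projHom (i : I) : StoneF.prodObj F I A ⟶ A i :=
  ⟨fun p => p i, continuous_apply i, fun p => le_iSup (fun j => (A j).v (p j)) i⟩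

end Prod

namespace StoneF

/-- The product object with its projections is a limit fan. -/
def prodIsLimit (F : Type) [Fintype F] [CompleteLattice F] (I : Type) (A : I → StoneF F) :
    Limits.IsLimit (Limits.Fan.mk (prodObj F I A) (projHom F I A)) :=
  Limits.Fan.IsLimit.mk _
    (fun s => ⟨fun x i => (s.proj i).1 x, continuous_pi fun i => (s.proj i).2.1,
      fun x => iSup_le fun i => (s.proj i).2.2 x⟩)
    (fun _ _ => rfl)
    (fun _ _ hm => Subtype.ext <| funext fun x => funext fun i =>
      congrFun (congrArg Subtype.val (hm i)) x)

section Equalizer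

variable {F : Type} [Lattice F] {A B : StoneF F} (f g : A ⟶ B)

lemma isClosed_eqLocus : IsClosed {x : A.X | f.1 x = g.1 x} :=
  isClosed_eq f.2.1 g.2.1

/-- The equalizer of two morphisms: the closed subspace on which they agree, with the
restricted value map. -/
def equalizerObj : StoneF F where
  X :=
    have : CompactSpace {x : A.X | f.1 x = g.1 x} :=
      isCompact_iff_compactSpace.mp (isClosed_eqLocus f g).isCompact
    Profinite.of {x : A.X | f.1 x = g.1 x}
  v x := A.v x.1
  closed S := (A.closed S).preimage continuous_subtype_val

/-- The inclusion of the equalizer. -/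
def equalizerHom : equalizerObj f g ⟶ A :=
  ⟨Subtype.val, continuous_subtype_val, fun _ => le_rfl⟩

lemma equalizerHom_condition : equalizerHom f g ≫ f = equalizerHom f g ≫ g :=
  Subtype.ext <| funext fun x => x.2

/-- The inclusion of the equalizer is a limit fork. -/
def equalizerIsLimit :
    Limits.IsLimit (Limits.Fork.ofι (equalizerHom f g) (equalizerHom_condition f g)) :=
  Limits.Fork.IsLimit.mk _
    (fun s => ⟨fun x => ⟨s.ι.1 x, congrFun (congrArg Subtype.val s.condition) x⟩,
      s.ι.2.1.subtype_mk _, s.ι.2.2⟩)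
    (fun _ => rfl)
    (fun _ _ hm => Subtype.ext <| funext fun x => Subtype.ext <|
      congrFun (congrArg Subtype.val hm) x)

instance (F : Type) [Lattice F] : Limits.HasEqualizers (StoneF F) :=
  have (A B : StoneF F) (f g : A ⟶ B) : Limits.HasLimit (Limits.parallelPair f g) :=
    ⟨⟨_, equalizerIsLimit f g⟩⟩
  Limits.hasEqualizers_of_hasLimit_parallelPair _

end Equalizer

end StoneF

/-- Let `F` be a finite lattice and `(X_i, v_i)_{i ∈ I}` a family of
objects of `Stone_F`.  Then the product space `∏ᵢ Xᵢ` with value map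
`v p = ⨆ i, v_i (p i)` is an object of `Stone_F` (this is part of the definition of
`StoneF.prodObj` above) and, together with the projections, is a categorical product of
the family in `Stone_F`.  Moreover, `Stone_F` has all small limits. -/
theorem stoneF_prod_isLimit_and_hasLimits
    (F : Type) [Fintype F] [CompleteLattice F] (I : Type) (A : I → StoneF F) :
    Nonempty (Limits.IsLimit (Limits.Fan.mk (StoneF.prodObj F I A) (StoneF.projHom F I A)))
      ∧ Limits.HasLimits (StoneF F) := by
  have : Limits.HasProducts.{0} (StoneF F) :=
    Limits.hasProducts_of_limit_fans _ fun f => StoneF.prodIsLimit F _ f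
  exact ⟨⟨StoneF.prodIsLimit F I A⟩, Limits.has_limits_of_hasEqualizers_and_products⟩
end

section
/- Let F be a finite lattice and let (C, w) be an object of Stone_F whose underlying space C is finite and discrete. Let ((X_i, v_i))_{i∈I} be a cofiltered diagram in Stone_F with limit (X, v) and limit projections p_i : (X, v) → (X_i, v_i). Then every morphism f : (X, v) → (C, w) in Stone_F factors through one of the projections: there exist i ∈ I and a Stone_F-morphism g : (X_i, v_i) → (C, w) with f = g ∘ p_i. Consequently, finite discrete objects are finitely copresentable in Stone_F. -/
open CategoryTheory

set_option autoImplicit false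

open Limits

namespace Profinite

variable {J : Type} [SmallCategory J] [IsCofiltered J] {D : J ⥤ Profinite.{0}}

/-- Compactness: compatible nonempty closed subsets of the terms of a cofiltered diagram of
profinite spaces have a common point in the limit. -/
theorem exists_mem_of_isLimit {c : Cone D} (hc : IsLimit c) (Z : ∀ j, Set (D.obj j))
    (hZ : ∀ j, IsClosed (Z j)) (hmap : ∀ {i j} (φ : i ⟶ j), Set.MapsTo (D.map φ) (Z i) (Z j))
    (hne : ∀ j, (Z j).Nonempty) : ∃ x : c.pt, ∀ j, c.π.app j x ∈ Z j := by
  let T : J ⥤ TopCat.{0} :=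
    { obj := fun j => TopCat.of (Z j)
      map := fun φ => TopCat.ofHom
        ⟨(hmap φ).restrict, (D.map φ).hom.hom.continuous.restrict (hmap φ)⟩
      map_id := fun j => by
        ext y
        exact ConcreteCategory.congr_hom (D.map_id j) y.1
      map_comp := fun φ ψ => by
        ext y
        exact ConcreteCategory.congr_hom (D.map_comp φ ψ) y.1 }
  have : ∀ j, Nonempty (T.obj j) := fun j => (hne j).to_subtype
  have : ∀ j, CompactSpace (T.obj j) := fun j => isCompact_iff_compactSpace.mp (hZ j).isCompact
  have : ∀ j, T2Space (T.obj j) := fun j => inferInstanceAs (T2Space (Z j))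
  obtain ⟨u⟩ := TopCat.nonempty_limitCone_of_compact_t2_cofiltered_system T
  let s : Cone D :=
    { pt := Profinite.of PUnit
      π :=
        { app := fun j => CompHausLike.ofHom _ (ContinuousMap.const _ (u.1 j).1)
          naturality := fun i j φ => by
            ext
            exact (congrArg Subtype.val (u.2 φ)).symm } }
  refine ⟨hc.lift s PUnit.unit, fun j => ?_⟩
  have h : c.π.app j (hc.lift s PUnit.unit) = (u.1 j).1 :=
    ConcreteCategory.congr_hom (hc.fac s j) PUnit.unit
  rw [h]
  exact (u.1 j).2

/-- Compatible closed subsets, indexed by the arrows into `j`, without a common point in the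
limit: one of them is empty. -/
theorem exists_eq_empty_of_isLimit {c : Cone D} (hc : IsLimit c) {j : J}
    (Z : ∀ k, (k ⟶ j) → Set (D.obj k)) (hZ : ∀ k φ, IsClosed (Z k φ))
    (hmap : ∀ {i k} (ψ : i ⟶ k) (φ : k ⟶ j), Set.MapsTo (D.map ψ) (Z i (ψ ≫ φ)) (Z k φ))
    (hx : ∀ x : c.pt, ∃ k φ, c.π.app k x ∉ Z k φ) : ∃ k φ, Z k φ = ∅ := by
  by_contra! hne
  obtain ⟨x, h⟩ := exists_mem_of_isLimit
    ((Functor.Initial.isLimitWhiskerEquiv (Over.forget j) c).symm hc)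
    (fun k => Z k.left k.hom) (fun k => hZ _ _)
    (fun {i k} ψ y hy => hmap ψ.left k.hom (by rwa [Over.w ψ])) (fun k => hne _ _)
  obtain ⟨k, φ, hk⟩ := hx x
  exact hk (h (Over.mk φ))

end Profinite

namespace StoneF

variable {F : Type} [Lattice F]

/-- The functor forgetting the `F`-valued map. -/
def toProfinite (F : Type) [Lattice F] : StoneF F ⥤ Profinite.{0} where
  obj A := A.X
  map f := CompHausLike.ofHom _ ⟨f.1, f.2.1⟩

/-- A profinite space with the constant map to the top element. -/
def constTop (F : Type) [Lattice F] [OrderTop F] : Profinite.{0} ⥤ StoneF F where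
  obj X := ⟨X, fun _ => ⊤, fun _ => isClosed_const⟩
  map f := ⟨f, f.hom.hom.continuous, fun _ => le_rfl⟩

/-- The constant map to the top element is left adjoint to forgetting. -/
def constTopAdj (F : Type) [Lattice F] [OrderTop F] : constTop F ⊣ toProfinite F :=
  Adjunction.mkOfHomEquiv
    { homEquiv := fun _ _ =>
        { toFun := fun f => CompHausLike.ofHom _ ⟨f.1, f.2.1⟩
          invFun := fun f => ⟨f, f.hom.hom.continuous, fun _ => le_top⟩
          left_inv := fun _ => rfl
          right_inv := fun _ => rfl }
      homEquiv_naturality_left_symm := fun _ _ => rfl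
      homEquiv_naturality_right := fun _ _ => rfl }

theorem preservesLimits_toProfinite [Finite F] [Nonempty F] :
    PreservesLimitsOfSize.{0, 0} (toProfinite F) := by
  cases nonempty_fintype F
  let : OrderTop F := Fintype.toOrderTop F
  exact (constTopAdj F).rightAdjoint_preservesLimits

variable {J : Type} [SmallCategory J] {D : J ⥤ StoneF F}

theorem π_map {c : Cone D} {i j : J} (φ : i ⟶ j) (x : c.pt.X) :
    (D.map φ).1 ((c.π.app i).1 x) = (c.π.app j).1 x :=
  congrFun (congrArg Subtype.val (c.w φ)) x

variable [IsCofiltered J]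

/-- The value of a point of a cofiltered limit is attained at some stage. -/
theorem exists_v_le_of_isLimit [Finite F] {c : Cone D} (hc : IsLimit c) (x : c.pt.X) :
    ∃ j, c.pt.v x ≤ (D.obj j).v ((c.π.app j).1 x) := by
  have hmax : ∀ x : c.pt.X, ∃ i, ∀ j,
      (D.obj j).v ((c.π.app j).1 x) ≤ (D.obj i).v ((c.π.app i).1 x) := by
    intro x
    have := IsCofiltered.nonempty (C := J)
    obtain ⟨_, ⟨i, rfl⟩, hi⟩ := (Set.toFinite (Set.range fun j =>
      (D.obj j).v ((c.π.app j).1 x))).exists_maximal (Set.range_nonempty _)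
    refine ⟨i, fun j => ?_⟩
    have hle : ∀ {k l : J} (_ : k ⟶ l),
        (D.obj l).v ((c.π.app l).1 x) ≤ (D.obj k).v ((c.π.app k).1 x) := fun φ => by
      rw [← π_map φ x]
      exact (D.map φ).2.2 _
    exact (hle (IsCofiltered.minToRight i j)).trans
      (hi ⟨IsCofiltered.min i j, rfl⟩ (hle (IsCofiltered.minToLeft i j)))
  choose m hm using hmax
  let B : StoneF F :=
    { X := c.pt.X
      v := fun x => (D.obj (m x)).v ((c.π.app (m x)).1 x)
      closed := fun S => by
        have : {x : c.pt.X | (D.obj (m x)).v ((c.π.app (m x)).1 x) ≤ S} =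
            ⋂ j, (c.π.app j).1 ⁻¹' {y | (D.obj j).v y ≤ S} := by
          ext x
          simp only [Set.mem_iInter]
          exact ⟨fun h j => (hm x j).trans h, fun h => h (m x)⟩
        rw [this]
        exact isClosed_iInter fun j => ((D.obj j).closed S).preimage (c.π.app j).2.1 }
  let s : Cone D :=
    { pt := B
      π :=
        { app := fun j => ⟨(c.π.app j).1, (c.π.app j).2.1, fun x => hm x j⟩
          naturality := fun i j φ => Subtype.ext (funext fun x => (π_map φ x).symm) } }
  let ι : c.pt ⟶ B := ⟨id, continuous_id, fun x => (c.π.app (m x)).2.2 x⟩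
  have h : ι ≫ hc.lift s = 𝟙 c.pt := hc.hom_ext fun j => by
    rw [Category.assoc, hc.fac, Category.id_comp]
    rfl
  have hx : (hc.lift s).1 x = x := congrFun (congrArg Subtype.val h) x
  exact ⟨m x, by simpa only [hx] using (hc.lift s).2.2 x⟩

/-- Compatible closed subsets, indexed by the arrows into `j`, without a common point in the
limit: one of them is empty. -/
theorem exists_eq_empty_of_isLimit [Finite F] {c : Cone D} (hc : IsLimit c) {j : J}
    (Z : ∀ k, (k ⟶ j) → Set (D.obj k).X) (hZ : ∀ k φ, IsClosed (Z k φ))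
    (hmap : ∀ {i k} (ψ : i ⟶ k) (φ : k ⟶ j), Set.MapsTo (D.map ψ).1 (Z i (ψ ≫ φ)) (Z k φ))
    (hx : ∀ x : c.pt.X, ∃ k φ, (c.π.app k).1 x ∉ Z k φ) : ∃ k φ, Z k φ = ∅ := by
  cases isEmpty_or_nonempty F
  · exact ⟨j, 𝟙 j, Set.eq_empty_of_forall_notMem fun y _ => isEmptyElim ((D.obj j).v y)⟩
  · have := preservesLimits_toProfinite (F := F)
    exact Profinite.exists_eq_empty_of_isLimit (isLimitOfPreserves (toProfinite F) hc) Z hZ hmap hx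

theorem exists_continuous_factorization [Finite F] {c : Cone D} (hc : IsLimit c)
    (A : StoneF F) [DiscreteTopology A.X] (f : c.pt ⟶ A) :
    ∃ (j : J) (g : (D.obj j).X → A.X), Continuous g ∧ ∀ x, g ((c.π.app j).1 x) = f.1 x := by
  cases isEmpty_or_nonempty F
  · obtain ⟨j⟩ := IsCofiltered.nonempty (C := J)
    have h (B : StoneF F) : IsEmpty B.X := ⟨fun y => isEmptyElim (B.v y)⟩
    have := h (D.obj j)
    have := h c.pt
    exact ⟨j, isEmptyElim, continuous_of_const isEmptyElim, isEmptyElim⟩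
  · have := preservesLimits_toProfinite (F := F)
    obtain ⟨j, g, hg⟩ := Profinite.exists_locallyConstant ((toProfinite F).mapCone c)
      (isLimitOfPreserves (toProfinite F) hc)
      (⟨f.1, (IsLocallyConstant.iff_continuous _).mpr f.2.1⟩ : LocallyConstant c.pt.X A.X)
    exact ⟨j, g, g.continuous, fun x => (LocallyConstant.congr_fun hg x).symm⟩

/-- A morphism from a cofiltered limit to a discrete object factors through a projection. -/
theorem exists_factorization [Finite F] {c : Cone D} (hc : IsLimit c)
    (A : StoneF F) [DiscreteTopology A.X] (f : c.pt ⟶ A) :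
    ∃ (j : J) (g : D.obj j ⟶ A), f = c.π.app j ≫ g := by
  obtain ⟨j, g, hg, hfg⟩ := exists_continuous_factorization hc A f
  obtain ⟨k, φ, h⟩ := exists_eq_empty_of_isLimit hc (j := j)
    (fun k φ => {y | ¬ A.v (g ((D.map φ).1 y)) ≤ (D.obj k).v y})
    (fun k φ => by
      have : {y | ¬ A.v (g ((D.map φ).1 y)) ≤ (D.obj k).v y} =
          ⋃ S : F, (g ∘ (D.map φ).1) ⁻¹' {a | ¬ A.v a ≤ S} ∩ {y | (D.obj k).v y ≤ S} := by
        ext y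
        simp only [Set.mem_iUnion]
        exact ⟨fun h => ⟨_, h, le_refl ((D.obj k).v y)⟩,
          fun ⟨S, h, hS⟩ hy => h (le_trans hy hS)⟩
      rw [this]
      exact isClosed_iUnion_of_finite fun S =>
        ((isClosed_discrete _).preimage (hg.comp (D.map φ).2.1)).inter ((D.obj k).closed S))
    (fun {i k} ψ φ y hy h => hy (by
      rw [D.map_comp]
      exact le_trans h ((D.map ψ).2.2 y)))
    (fun x => by
      obtain ⟨i, hi⟩ := exists_v_le_of_isLimit hc x
      refine ⟨IsCofiltered.min i j, IsCofiltered.minToRight i j, not_not.mpr ?_⟩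
      rw [π_map, hfg]
      refine (f.2.2 x).trans (hi.trans ?_)
      rw [← π_map (IsCofiltered.minToLeft i j) x]
      exact (D.map _).2.2 _)
  refine ⟨k, ⟨g ∘ (D.map φ).1, hg.comp (D.map φ).2.1, fun y => ?_⟩, ?_⟩
  · by_contra hy
    exact (Set.eq_empty_iff_forall_notMem.mp h y) hy
  · refine Subtype.ext (funext fun x => ?_)
    rw [← hfg x, ← π_map φ x]
    rfl

/-- Morphisms to a discrete object that agree on a cofiltered limit agree at some stage. -/
theorem exists_map_comp_eq [Finite F] {c : Cone D} (hc : IsLimit c)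
    (A : StoneF F) [DiscreteTopology A.X] {j : J} (f g : D.obj j ⟶ A)
    (hfg : c.π.app j ≫ f = c.π.app j ≫ g) :
    ∃ (k : J) (φ : k ⟶ j), D.map φ ≫ f = D.map φ ≫ g := by
  obtain ⟨k, φ, h⟩ := exists_eq_empty_of_isLimit hc (j := j)
    (fun k φ => {y | (D.map φ ≫ f).1 y ≠ (D.map φ ≫ g).1 y})
    (fun k φ => (isClosed_discrete {p : A.X × A.X | p.1 ≠ p.2}).preimage
      ((D.map φ ≫ f).2.1.prodMk (D.map φ ≫ g).2.1))
    (fun {i k} ψ φ y hy => by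
      rw [D.map_comp] at hy
      exact hy)
    (fun x => by
      refine ⟨j, 𝟙 j, not_not.mpr ?_⟩
      rw [D.map_id, Category.id_comp, Category.id_comp]
      exact congrFun (congrArg Subtype.val hfg) x)
  refine ⟨k, φ, Subtype.ext (funext fun y => ?_)⟩
  by_contra hy
  exact (Set.eq_empty_iff_forall_notMem.mp h y) hy

end StoneF

/-- Let `F` be a finite lattice and `(C, w)` an object of `Stone_F`
whose underlying space is finite and discrete.  For every cofiltered diagram
`D : J ⥤ Stone_F` with limit cone `c` (limit projections `c.π.app j`), every morphism
`f : c.pt ⟶ (C, w)` factors through one of the projections.  Consequently, finite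
discrete objects are finitely copresentable in `Stone_F`: `Hom(−, (C,w))` sends
cofiltered limits to filtered colimits, i.e. the functor `yoneda.obj (C, w)` on
`(Stone_F)ᵒᵖ` preserves filtered colimits. -/
theorem stoneF_finite_discrete_finitely_copresentable
    (F : Type) [Fintype F] [Lattice F]
    (A : StoneF F) (hfin : Finite A.X) (hdisc : DiscreteTopology A.X) :
    (∀ (J : Type) [SmallCategory J] [IsCofiltered J]
        (D : J ⥤ StoneF F) (c : Limits.Cone D), Limits.IsLimit c →
        ∀ f : c.pt ⟶ A, ∃ (j : J) (g : D.obj j ⟶ A), f = c.π.app j ≫ g)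
      ∧ Limits.PreservesFilteredColimits (yoneda.obj A) := by
  refine ⟨fun J _ _ D c hc f => StoneF.exists_factorization hc A f,
    ⟨fun J _ _ => ⟨fun {K} => ⟨fun {c} hc => ⟨?_⟩⟩⟩⟩⟩
  have hc' := isLimitConeLeftOpOfCocone K hc
  refine Types.FilteredColimit.isColimitOf' _ _ (fun f => ?_) (fun j f g hfg => ?_)
  · obtain ⟨j, g, h⟩ := StoneF.exists_factorization hc' A f
    exact ⟨j.unop, g, h⟩
  · obtain ⟨k, φ, h⟩ := StoneF.exists_map_comp_eq hc' A (j := .op j) f g hfg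
    exact ⟨k.unop, φ.unop, h⟩
end

section
/- Let F be a finite lattice. Every object (X, v) of Stone_F is isomorphic in Stone_F to the limit of a cofiltered diagram in Stone_F all of whose objects have finite discrete underlying spaces. -/
open CategoryTheory

set_option autoImplicit false

/-- A (small) cofiltered diagram in a category `C`. -/
structure CofiltDiag (C : Type*) [Category C] where
  J : Type
  [cat : SmallCategory J]
  [cof : IsCofiltered J]
  D : J ⥤ C

attribute [instance] CofiltDiag.cat CofiltDiag.cof

namespace StoneF

variable {F : Type} [Fintype F] [Lattice F]

open Classical in
/-- The finite set of values taken by `v` on a class of a discrete quotient. -/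
noncomputable def fiberValues (A : StoneF F) (Q : DiscreteQuotient A.X) (q : Q) : Finset F :=
  Finset.univ.filter fun a => ∃ x, Q.proj x = q ∧ A.v x = a

lemma fiberValues_nonempty (A : StoneF F) (Q : DiscreteQuotient A.X) (q : Q) :
    (A.fiberValues Q q).Nonempty := by
  obtain ⟨x, hx⟩ := Q.proj_surjective q
  exact ⟨A.v x, by simpa [fiberValues] using ⟨x, hx, rfl⟩⟩

/-- The infimum of `v` over a class of a discrete quotient. -/
noncomputable def fiberInf (A : StoneF F) (Q : DiscreteQuotient A.X) (q : Q) : F :=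
  (A.fiberValues Q q).inf' (A.fiberValues_nonempty Q q) id

lemma le_fiberInf_iff (A : StoneF F) (Q : DiscreteQuotient A.X) (q : Q) (a : F) :
    a ≤ A.fiberInf Q q ↔ ∀ x, Q.proj x = q → a ≤ A.v x := by
  simp [fiberInf, fiberValues, Finset.le_inf'_iff]

lemma fiberInf_proj_le (A : StoneF F) (Q : DiscreteQuotient A.X) (x : A.X) :
    A.fiberInf Q (Q.proj x) ≤ A.v x :=
  (A.le_fiberInf_iff Q _ _).1 le_rfl x rfl

lemma fiberInf_ofLE_le (A : StoneF F) {Q R : DiscreteQuotient A.X} (h : Q ≤ R) (q : Q) :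
    A.fiberInf R (DiscreteQuotient.ofLE h q) ≤ A.fiberInf Q q := by
  rw [le_fiberInf_iff]
  rintro x rfl
  exact A.fiberInf_proj_le R x

lemma isOpen_setOf_le (A : StoneF F) (a : F) : IsOpen {y : A.X | a ≤ A.v y} := by
  have h : {y : A.X | a ≤ A.v y} = ⋂ S ∈ {S : F | ¬ a ≤ S}, {y : A.X | A.v y ≤ S}ᶜ := by
    ext y
    simp only [Set.mem_ofPred_eq, Set.mem_iInter, Set.mem_compl_iff]
    exact ⟨fun hy S hS hyS => hS (hy.trans hyS), fun hy => by_contra fun hn => hy _ hn le_rfl⟩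
  rw [h]
  exact (Set.toFinite _).isOpen_biInter fun S _ => (A.closed S).isOpen_compl

lemma exists_le_fiberInf_proj (A : StoneF F) (x : A.X) :
    ∃ Q : DiscreteQuotient A.X, A.v x ≤ A.fiberInf Q (Q.proj x) := by
  obtain ⟨U, hU, hxU, hUv⟩ :=
    compact_exists_isClopen_in_isOpen (A.isOpen_setOf_le (A.v x)) (le_refl (A.v x))
  refine ⟨DiscreteQuotient.ofIsClopen hU, (A.le_fiberInf_iff _ _ _).2 fun y hy => hUv ?_⟩
  exact (Quotient.exact hy).2 hxU

/-- A discrete quotient of an object of `Stone_F`, with the fiberwise infimum of `v`. -/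
noncomputable def quotientObj (A : StoneF F) (Q : DiscreteQuotient A.X) : StoneF F where
  X := Profinite.of Q
  v := A.fiberInf Q
  closed _ := isClosed_discrete (α := Q) _

/-- The diagram of discrete quotients of an object of `Stone_F`. -/
noncomputable def quotientDiagram (A : StoneF F) : DiscreteQuotient A.X ⥤ StoneF F where
  obj := A.quotientObj
  map f := ⟨DiscreteQuotient.ofLE (leOfHom f), DiscreteQuotient.ofLE_continuous _,
    A.fiberInf_ofLE_le (leOfHom f)⟩
  map_id _ := Subtype.ext (funext fun q => DiscreteQuotient.ofLE_refl_apply q)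
  map_comp f g := Subtype.ext (funext fun q =>
    (DiscreteQuotient.ofLE_ofLE (leOfHom f) (leOfHom g) q).symm)

/-- The projections of an object of `Stone_F` onto its discrete quotients. -/
noncomputable def quotientCone (A : StoneF F) : Limits.Cone A.quotientDiagram where
  pt := A
  π :=
    { app Q := ⟨Q.proj, Q.proj_continuous, A.fiberInf_proj_le Q⟩
      naturality _ _ _ := rfl }

lemma continuous_of_forall_proj {X Y : Type*} [TopologicalSpace X] [CompactSpace X] [T2Space X]
    [TotallyDisconnectedSpace X] [TopologicalSpace Y] {f : Y → X}
    (h : ∀ Q : DiscreteQuotient X, Continuous (Q.proj ∘ f)) : Continuous f := by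
  refine (isTopologicalBasis_isClopen (X := X)).continuous_iff.2 fun U hU => ?_
  let Q := DiscreteQuotient.ofIsClopen hU
  have hQ : f ⁻¹' U = (Q.proj ∘ f) ⁻¹' (Q.proj '' U) := by
    ext y
    refine ⟨fun hy => ⟨f y, hy, rfl⟩, ?_⟩
    rintro ⟨x, hx, hxy⟩
    exact (Quotient.exact hxy).1 hx
  rw [hQ]
  exact (isOpen_discrete _).preimage (h Q)

lemma exists_proj_eq_of_cone (A : StoneF F) (s : Limits.Cone A.quotientDiagram) (y : s.pt.X) :
    ∃ x : A.X, ∀ Q : DiscreteQuotient A.X, Q.proj x = (s.π.app Q).1 y :=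
  DiscreteQuotient.exists_of_compat (fun Q => (s.π.app Q).1 y) fun _ _ h =>
    congrFun (congrArg Subtype.val (s.w (homOfLE h))) y

/-- The map to an object of `Stone_F` induced by a cone over its discrete quotients. -/
noncomputable def quotientLift (A : StoneF F) (s : Limits.Cone A.quotientDiagram) (y : s.pt.X) :
    A.X :=
  (A.exists_proj_eq_of_cone s y).choose

lemma proj_quotientLift (A : StoneF F) (s : Limits.Cone A.quotientDiagram) (y : s.pt.X)
    (Q : DiscreteQuotient A.X) : Q.proj (A.quotientLift s y) = (s.π.app Q).1 y :=
  (A.exists_proj_eq_of_cone s y).choose_spec Q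

lemma continuous_quotientLift (A : StoneF F) (s : Limits.Cone A.quotientDiagram) :
    Continuous (A.quotientLift s) :=
  continuous_of_forall_proj fun Q => by
    rw [show Q.proj ∘ A.quotientLift s = (s.π.app Q).1 from
      funext fun y => A.proj_quotientLift s y Q]
    exact (s.π.app Q).2.1

lemma v_quotientLift_le (A : StoneF F) (s : Limits.Cone A.quotientDiagram) (y : s.pt.X) :
    A.v (A.quotientLift s y) ≤ s.pt.v y := by
  obtain ⟨Q, hQ⟩ := A.exists_le_fiberInf_proj (A.quotientLift s y)
  rw [proj_quotientLift] at hQ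
  exact hQ.trans ((s.π.app Q).2.2 y)

/-- An object of `Stone_F` is the limit of its discrete quotients. -/
noncomputable def quotientConeIsLimit (A : StoneF F) : Limits.IsLimit A.quotientCone where
  lift s := ⟨A.quotientLift s, A.continuous_quotientLift s, A.v_quotientLift_le s⟩
  fac s Q := Subtype.ext (funext fun y => A.proj_quotientLift s y Q)
  uniq s _ hm := Subtype.ext (funext fun y =>
    DiscreteQuotient.eq_of_forall_proj_eq (X := A.X) fun Q =>
      (congrFun (congrArg Subtype.val (hm Q)) y).trans (A.proj_quotientLift s y Q).symm)

end StoneF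

/-- Let `F` be a finite lattice.  Every object `(X, v)` of `Stone_F` is
isomorphic in `Stone_F` to the limit of a cofiltered diagram in `Stone_F` all of whose
objects have finite discrete underlying spaces. -/
theorem stoneF_obj_cofiltered_limit_of_finite_discrete
    (F : Type) [Fintype F] [Lattice F] (A : StoneF F) :
    ∃ (E : CofiltDiag (StoneF F)) (c : Limits.Cone E.D) (_ : Limits.IsLimit c),
      (∀ j : E.J, Finite (E.D.obj j).X ∧ DiscreteTopology (E.D.obj j).X)
        ∧ Nonempty (c.pt ≅ A) := by
  refine ⟨⟨DiscreteQuotient A.X, A.quotientDiagram⟩, A.quotientCone, A.quotientConeIsLimit,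
    fun Q => ⟨?_, ?_⟩, ⟨Iso.refl A⟩⟩
  · exact inferInstanceAs (Finite (Q : DiscreteQuotient A.X))
  · exact inferInstanceAs (DiscreteTopology (Q : DiscreteQuotient A.X))
end

section
/- Let F be a finite lattice, X a Stone space, I any index type, and for each i ∈ I let (X_i, v_i) be an object of Stone_F and f_i : X → X_i a continuous map. Define v : X → F by v(x) = ⋁_{i∈I} v_i(f_i(x)) (which exists since F is finite). Then: (1) (X, v) is an object of Stone_F; (2) each f_i is a Stone_F-morphism (X, v) → (X_i, v_i); and (3) for every object (Y, w) of Stone_F and every continuous map g : Y → X, the map g is a Stone_F-morphism (Y, w) → (X, v) if and only if f_i ∘ g is a Stone_F-morphism (Y, w) → (X_i, v_i) for every i ∈ I. In other words, every structured source over the forgetful functor U : Stone_F → Stone has an initial lift, so U is a topological functor. -/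
open CategoryTheory

set_option autoImplicit false

/-- Let `F` be a finite lattice, `X` a Stone space, `(X_i, v_i)_{i ∈ I}`
a family of objects of `Stone_F` and `f_i : X → X_i` continuous maps.  Define
`v x = ⨆ i, v_i (f_i x)`.  Then `(X, v)` is an object of `Stone_F`, each `f_i` is a
`Stone_F`-morphism `(X, v) → (X_i, v_i)`, and for every object `(Y, w)` of `Stone_F` and
every continuous `g : Y → X`, the map `g` is a `Stone_F`-morphism `(Y, w) → (X, v)` iff
each composite `f_i ∘ g` is a `Stone_F`-morphism `(Y, w) → (X_i, v_i)`.  That is, every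
structured source over the forgetful functor `U : Stone_F → Stone` has an initial lift,
so `U` is a topological functor. -/
theorem stoneF_forgetful_initial_lift
    (F : Type) [Fintype F] [CompleteLattice F]
    (X : Profinite.{0}) (I : Type*) (A : I → StoneF F) (f : ∀ i, C(X, (A i).X)) :
    (∀ S : F, IsClosed {x : X | (⨆ i, (A i).v (f i x)) ≤ S})
      ∧ (∀ (i : I) (x : X), (A i).v (f i x) ≤ ⨆ j, (A j).v (f j x))
      ∧ (∀ (B : StoneF F) (g : C(B.X, X)),
          ((∀ y, (⨆ i, (A i).v (f i (g y))) ≤ B.v y)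
            ↔ ∀ (i : I) (y : B.X), (A i).v (f i (g y)) ≤ B.v y)) := by
  refine ⟨fun S => ?_, fun i x => le_iSup (fun j => (A j).v (f j x)) i, fun B g => ?_⟩
  · simp only [iSup_le_iff, Set.ofPred_forall]
    exact isClosed_iInter fun i => ((A i).closed S).preimage (f i).continuous
  · simp only [iSup_le_iff]
    exact forall_comm
end

section
/- Let F be a finite lattice, regarded as a discrete topological space, let X be a set regarded as a discrete space, and let v : X → F be a function. Let ṽ : βX → F be the unique continuous extension of v to the Stone–Čech compactification βX of X (which exists since F is finite, discrete, compact and Hausdorff). Then (βX, ṽ) is an object of Stone_F, and for every object (Y, w) of Stone_F and every function f : X → Y satisfying w(f(x)) ≤ v(x) for all x ∈ X, the unique continuous extension f̃ : βX → Y of f satisfies w(f̃(z)) ≤ ṽ(z) for all z ∈ βX; that is, f̃ is the unique Stone_F-morphism (βX, ṽ) → (Y, w) extending f. -/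
open CategoryTheory

set_option autoImplicit false

attribute [local instance] ConcreteCategory.instFunLike

/-- Let `F` be a finite lattice regarded as a discrete space, `X` a set
regarded as a discrete space and `v : X → F`.  Let `ṽ : βX → F` be the unique continuous
extension of `v` to the Stone–Čech compactification of `X`.  Then `(βX, ṽ)` is an object
of `Stone_F` (βX is a Stone space, and the down-set preimages under `ṽ` are closed), and
for every object `(Y, w)` of `Stone_F` and every function `f : X → Y` with
`w (f x) ≤ v x` for all `x`, the unique continuous extension `f̃ : βX → Y` of `f`
satisfies `w (f̃ z) ≤ ṽ z` for all `z ∈ βX`; i.e. `f̃` is the unique `Stone_F`-morphism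
`(βX, ṽ) → (Y, w)` extending `f`. -/
theorem stoneCech_stoneF
    (F : Type) [Fintype F] [Lattice F] [TopologicalSpace F] [DiscreteTopology F]
    (X : Type) [TopologicalSpace X] [DiscreteTopology X] (v : X → F) :
    -- `βX` is a Stone space
    TotallyDisconnectedSpace (StoneCech X)
      -- `ṽ` extends `v` and `(βX, ṽ)` is an object of `Stone_F`
      ∧ (∀ x : X,
          stoneCechExtend (continuous_of_discreteTopology (f := v)) (stoneCechUnit x) = v x)
      ∧ (∀ S : F,
          IsClosed {z : StoneCech X |
            stoneCechExtend (continuous_of_discreteTopology (f := v)) z ≤ S})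
      -- the universal property with respect to `Stone_F`
      ∧ (∀ (B : StoneF F) (f : X → B.X), (∀ x, B.v (f x) ≤ v x) →
          (∀ z : StoneCech X,
              B.v (stoneCechExtend (continuous_of_discreteTopology (f := f)) z)
                ≤ stoneCechExtend (continuous_of_discreteTopology (f := v)) z)
            ∧ (∀ x : X,
                stoneCechExtend (continuous_of_discreteTopology (f := f)) (stoneCechUnit x)
                  = f x)
            ∧ (∀ g : StoneCech X → B.X, Continuous g → (∀ x, g (stoneCechUnit x) = f x) →
                g = stoneCechExtend (continuous_of_discreteTopology (f := f)))) := by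
  refine ⟨?_, fun x => stoneCechExtend_stoneCechUnit _ x, fun S => ?_, fun B f hf =>
    ⟨fun z => ?_, fun x => stoneCechExtend_stoneCechUnit _ x, fun g hg hgf => ?_⟩⟩
  · have : ExtremallyDisconnected (StoneCech X) :=
      CompactT2.Projective.extremallyDisconnected StoneCech.projective
    infer_instance
  · exact (isClosed_discrete {T : F | T ≤ S}).preimage (continuous_stoneCechExtend _)
  · set e := stoneCechExtend (continuous_of_discreteTopology (f := v))
    set e' := stoneCechExtend (continuous_of_discreteTopology (f := f))
    have hclosed : IsClosed ({y | e y ≠ e z} ∪ {y | B.v (e' y) ≤ e z}) :=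
      ((isClosed_discrete {T : F | T ≠ e z}).preimage (continuous_stoneCechExtend _)).union
        ((B.closed (e z)).preimage (continuous_stoneCechExtend _))
    have hmem : z ∈ {y | e y ≠ e z} ∪ {y | B.v (e' y) ≤ e z} := by
      refine hclosed.closure_subset_iff.2 ?_ (denseRange_stoneCechUnit z)
      rintro _ ⟨x, rfl⟩
      by_cases hx : e (stoneCechUnit x) = e z
      · right
        have hv : e (stoneCechUnit x) = v x := stoneCechExtend_stoneCechUnit _ x
        have hfx : e' (stoneCechUnit x) = f x := stoneCechExtend_stoneCechUnit _ x
        simpa only [Set.mem_ofPred_eq, hfx, ← hx, hv] using hf x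
      · exact Or.inl hx
    exact hmem.resolve_left fun h => h rfl
  · exact stoneCech_hom_ext hg (continuous_stoneCechExtend _)
      (funext fun x => (hgf x).trans (stoneCechExtend_stoneCechUnit _ x).symm)
end
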